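/- Under the additive bias model, the interventional (bias-free) conditional mean is identified by conditioning on the unbiased units: for an event B = {Z = z, E = e} with P(B) > 0 and P(B ∩ {A = 0}) > 0, if the noise satisfies the conditional mean-independence conditions E[ε·1_B] = 0 and E[ε·1_{B ∩ {A=0}}] = 0, then E[Y_true·1_B]/P(B) = E[Y_obs·1_{B ∩ {A=0}}]/P(B ∩ {A = 0}); that is, the conditional mean of the true (do(A=0)) outcome given (E,Z) = (e,z) equals the conditional mean of the observed outcome among unbiased units with (E,Z) = (e,z). -/

import Mathlib

open MeasureTheory ProbabilityTheory

/-- A constant plus a noise term integrating to zero on `S` has mean that constant on `S`. -/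
theorem setIntegral_div_eq_of_eqOn_const_add {Ω : Type*} [MeasurableSpace Ω] {P : Measure Ω}
    [IsFiniteMeasure P] {S : Set Ω} (hS : MeasurableSet S) (hPS : P S ≠ 0) {Y ε : Ω → ℝ} {c : ℝ}
    (hε : IntegrableOn ε S P) (hε0 : ∫ ω in S, ε ω ∂P = 0) (hY : ∀ ω ∈ S, Y ω = c + ε ω) :
    (∫ ω in S, Y ω ∂P) / (P S).toReal = c := by
  have hPS' : (P S).toReal ≠ 0 := ENNReal.toReal_ne_zero.2 ⟨hPS, measure_ne_top P S⟩
  rw [setIntegral_congr_fun hS hY, integral_add (integrable_const c) hε, hε0, add_zero,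
    setIntegral_const, smul_eq_mul, measureReal_def, mul_div_cancel_left₀ c hPS']

/-- Under the additive bias model, the interventional (bias-free) conditional
mean is identified by conditioning on the unbiased units. -/
theorem identification_do_A_eq_zero
    {Ω : Type*} [MeasurableSpace Ω] (P : Measure Ω) [IsProbabilityMeasure P]
    {dz de : ℕ} (Z : Ω → (Fin dz → ℝ)) (E : Ω → (Fin de → ℝ)) (A : Ω → ℝ) (ε : Ω → ℝ)
    (g : (Fin dz → ℝ) × (Fin de → ℝ) → ℝ) (α : ℝ)
    (hZ : Measurable Z) (hE : Measurable E) (hA : Measurable A)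
    (hA01 : ∀ ω, A ω = 0 ∨ A ω = 1) (hε : Integrable ε P) (hg : Measurable g)
    (Ytrue Yobs : Ω → ℝ)
    (hYtrue : ∀ ω, Ytrue ω = g (Z ω, E ω) + ε ω)
    (hYobs : ∀ ω, Yobs ω = Ytrue ω + α * A ω)
    (z : Fin dz → ℝ) (e : Fin de → ℝ)
    (B : Set Ω) (hB : B = {ω | Z ω = z ∧ E ω = e})
    (hPB : 0 < P B) (hPB0 : 0 < P (B ∩ {ω | A ω = 0}))
    (hεB : ∫ ω in B, ε ω ∂P = 0)
    (hεB0 : ∫ ω in B ∩ {ω | A ω = 0}, ε ω ∂P = 0) :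
    (∫ ω in B, Ytrue ω ∂P) / (P B).toReal
      = (∫ ω in B ∩ {ω | A ω = 0}, Yobs ω ∂P) / (P (B ∩ {ω | A ω = 0})).toReal := by
  have hBm : MeasurableSet B := by
    rw [hB]
    exact (hZ (measurableSet_singleton z)).inter (hE (measurableSet_singleton e))
  have hY : ∀ ω ∈ B, Ytrue ω = g (z, e) + ε ω := by
    intro ω hω
    rw [hB] at hω
    rw [hYtrue, hω.1, hω.2]
  have hY0 : ∀ ω ∈ B ∩ {ω | A ω = 0}, Yobs ω = g (z, e) + ε ω := by
    rintro ω ⟨hω, hAω : A ω = 0⟩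
    rw [hYobs, hAω, mul_zero, add_zero, hY ω hω]
  have hB0m : MeasurableSet (B ∩ {ω | A ω = 0}) :=
    hBm.inter (hA (measurableSet_singleton 0))
  rw [setIntegral_div_eq_of_eqOn_const_add hBm hPB.ne' hε.integrableOn hεB hY,
    setIntegral_div_eq_of_eqOn_const_add hB0m hPB0.ne' hε.integrableOn hεB0 hY0]
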